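/- Let $n \geq 1$ and suppose smooth functions $\Gamma^{ij}_k$, $w^i_\alpha$ on an open convex subset $U \subseteq \mathbb{R}^n$ satisfy, with a symmetric constant matrix $(c^{\alpha\beta})$ and $w^i_{\alpha k} := \partial_k w^i_\alpha$, the condition $\partial_l \Gamma^{ij}_k - \partial_k \Gamma^{ij}_l = c^{\alpha\beta}( w^j_{\alpha k} w^i_{\beta l} - w^i_{\alpha k} w^j_{\beta l})$. Then for each pair $(i,j)$ there exists a smooth function $r^{ij}$ on $U$ such that $\Gamma^{ij}_k + c^{\alpha\beta} w^i_{\alpha k} w^j_\beta = \partial_k r^{ij}$ for all $k$. -/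

import Mathlib

/-- Partial derivative `∂ₖ` of a scalar function on `ℝⁿ`. -/
noncomputable def pd {n : ℕ} (f : (Fin n → ℝ) → ℝ) (k : Fin n) (u : Fin n → ℝ) : ℝ :=
  fderiv ℝ f u (Pi.single k 1)

open scoped ContDiff

section PartialDerivatives

variable {n : ℕ} {U : Set (Fin n → ℝ)} {f g : (Fin n → ℝ) → ℝ} {u : Fin n → ℝ}

lemma fderiv_apply_eq_sum_pd (f : (Fin n → ℝ) → ℝ) (u x : Fin n → ℝ) :
    fderiv ℝ f u x = ∑ l, x l * pd f l u := by
  conv_lhs => rw [pi_eq_sum_univ' x]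
  simp [pd, map_sum]

lemma ContDiffOn.pd (hf : ContDiffOn ℝ ∞ f U) (hU : IsOpen U) (k : Fin n) :
    ContDiffOn ℝ ∞ (pd f k) U :=
  (hf.fderiv_of_isOpen hU (by simp)).clm_apply contDiffOn_const

lemma pd_comm (hf : ContDiffOn ℝ ∞ f U) (hU : IsOpen U) (hu : u ∈ U) (k l : Fin n) :
    pd (pd f k) l u = pd (pd f l) k u := by
  have hd : DifferentiableAt ℝ (fderiv ℝ f) u :=
    ((hf.fderiv_of_isOpen (m := 1) hU (by norm_cast)).contDiffAt
      (hU.mem_nhds hu)).differentiableAt (by simp)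
  have key (k l : Fin n) :
      pd (pd f k) l u = fderiv ℝ (fderiv ℝ f) u (Pi.single l 1) (Pi.single k 1) := by
    change fderiv ℝ (fun v => fderiv ℝ f v (Pi.single k 1)) u _ = _
    simp [fderiv_clm_apply hd (differentiableAt_const _)]
  have hsymm : IsSymmSndFDerivAt ℝ f u :=
    (hf.contDiffAt (hU.mem_nhds hu)).isSymmSndFDerivAt (by simp; norm_cast)
  rw [key, key, hsymm]

lemma pd_add (hf : DifferentiableAt ℝ f u) (hg : DifferentiableAt ℝ g u) (l : Fin n) :
    pd (fun v => f v + g v) l u = pd f l u + pd g l u := by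
  simp [pd, fderiv_fun_add hf hg]

lemma pd_sum {ι : Type*} {s : Finset ι} {f : ι → (Fin n → ℝ) → ℝ}
    (hf : ∀ a ∈ s, DifferentiableAt ℝ (f a) u) (l : Fin n) :
    pd (fun v => ∑ a ∈ s, f a v) l u = ∑ a ∈ s, pd (f a) l u := by
  simp [pd, fderiv_fun_sum hf]

lemma pd_const_mul_mul (c : ℝ) (hf : DifferentiableAt ℝ f u) (hg : DifferentiableAt ℝ g u)
    (l : Fin n) :
    pd (fun v => c * f v * g v) l u = c * (pd f l u * g u + f u * pd g l u) := by
  simp only [pd, fderiv_fun_mul (hf.const_mul c) hg, fderiv_const_mul hf]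
  simp
  ring

/-- Poincaré lemma: a smooth closed `1`-form, given by its components, on an open convex subset
of `ℝⁿ` has a smooth primitive. -/
lemma exists_contDiffOn_forall_pd_eq (hU : IsOpen U) (hUc : Convex ℝ U)
    {F : Fin n → (Fin n → ℝ) → ℝ} (hF : ∀ k, ContDiffOn ℝ ∞ (F k) U)
    (hclosed : ∀ k l, ∀ u ∈ U, pd (F k) l u = pd (F l) k u) :
    ∃ r : (Fin n → ℝ) → ℝ, ContDiffOn ℝ ∞ r U ∧ ∀ k, ∀ u ∈ U, pd r k u = F k u := by
  let e (k : Fin n) : (Fin n → ℝ) →L[ℝ] ℝ := ContinuousLinearMap.proj k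
  let η : (Fin n → ℝ) → (Fin n → ℝ) →L[ℝ] ℝ := fun u => ∑ k, F k u • e k
  have hη : ContDiffOn ℝ ∞ η U :=
    ContDiffOn.sum fun k _ => (hF k).smul contDiffOn_const
  have hη_diff : DifferentiableOn ℝ η U := hη.differentiableOn (by simp)
  have hη_apply (u) (x) : η u x = ∑ k, F k u * x k := by simp [η, e]
  have hdη (a) (ha : a ∈ U) (x y) :
      fderiv ℝ η a x y = ∑ k, ∑ l, x l * y k * pd (F k) l a := by
    have hFd (k) : DifferentiableAt ℝ (F k) a :=
      ((hF k).contDiffAt (hU.mem_nhds ha)).differentiableAt (by simp)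
    have h : HasFDerivAt η (∑ k, (fderiv ℝ (F k) a).smulRight (e k)) a :=
      HasFDerivAt.fun_sum fun k _ => (hFd k).hasFDerivAt.smul_const (e k)
    rw [h.fderiv]
    simp only [e, sum_apply, ContinuousLinearMap.smulRight_apply,
      smul_apply, ContinuousLinearMap.proj_apply, smul_eq_mul,
      fderiv_apply_eq_sum_pd, Finset.sum_mul]
    exact Finset.sum_congr rfl fun k _ => Finset.sum_congr rfl fun l _ => by ring
  obtain ⟨r, hr⟩ := hUc.exists_forall_hasFDerivAt_of_fderiv_symmetric hU hη_diff fun a ha x y => by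
    rw [hdη a ha, hdη a ha, Finset.sum_comm]
    refine Finset.sum_congr rfl fun k _ => Finset.sum_congr rfl fun l _ => ?_
    rw [hclosed l k a ha]
    ring
  refine ⟨r, ?_, fun k u hu => ?_⟩
  · rw [contDiffOn_infty_iff_fderiv_of_isOpen hU]
    exact ⟨fun u hu => (hr u hu).differentiableAt.differentiableWithinAt,
      hη.congr fun u hu => (hr u hu).fderiv⟩
  · simp [pd, (hr u hu).fderiv, hη_apply, Pi.single_apply]

end PartialDerivatives

/-- Lemma 3.7: on an open convex set, the 1-form with components
`Γ^{ij}_k + c^{αβ} w^i_{αk} w^j_β` is closed (by the compatibility condition), hence exact: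
there exists a potential `r^{ij}` with `∂_k r^{ij} = Γ^{ij}_k + c^{αβ} (∂_k w^i_α) w^j_β`. -/
theorem existence_of_potential_r
    (n : ℕ) (hn : 1 ≤ n)
    (ι : Type) [Fintype ι]
    (U : Set (Fin n → ℝ)) (hU : IsOpen U) (hUc : Convex ℝ U)
    (Γ : Fin n → Fin n → Fin n → (Fin n → ℝ) → ℝ)
    (cmat : ι → ι → ℝ) (hcmat : ∀ α β, cmat α β = cmat β α)
    (wpot : ι → Fin n → (Fin n → ℝ) → ℝ)
    (hΓs : ∀ i j k, ContDiffOn ℝ (⊤ : ℕ∞) (Γ i j k) U)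
    (hwpots : ∀ α i, ContDiffOn ℝ (⊤ : ℕ∞) (wpot α i) U)
    -- compatibility condition, with w^i_{αk} := ∂_k w^i_α
    (hcomp : ∀ i j k l, ∀ u ∈ U,
      pd (Γ i j k) l u - pd (Γ i j l) k u
        = ∑ α, ∑ β, cmat α β *
            (pd (wpot α j) k u * pd (wpot β i) l u
             - pd (wpot α i) k u * pd (wpot β j) l u)) :
    ∀ i j, ∃ r : (Fin n → ℝ) → ℝ, ContDiffOn ℝ (⊤ : ℕ∞) r U ∧
      ∀ k, ∀ u ∈ U,
        pd r k u = Γ i j k u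
          + ∑ α, ∑ β, cmat α β * pd (wpot α i) k u * wpot β j u := by
  intro i j
  have hw (α i) : ContDiffOn ℝ ∞ (wpot α i) U := hwpots α i
  have hdiff {f : (Fin n → ℝ) → ℝ} (hf : ContDiffOn ℝ ∞ f U) {u} (hu : u ∈ U) :
      DifferentiableAt ℝ f u :=
    (hf.contDiffAt (hU.mem_nhds hu)).differentiableAt (by simp)
  have hterm (k) (α β) :
      ContDiffOn ℝ ∞ (fun u => cmat α β * pd (wpot α i) k u * wpot β j u) U :=
    (contDiffOn_const.mul ((hw α i).pd hU k)).mul (hw β j)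
  have hrow (k) (α) :
      ContDiffOn ℝ ∞ (fun u => ∑ β, cmat α β * pd (wpot α i) k u * wpot β j u) U :=
    ContDiffOn.sum fun β _ => hterm k α β
  have hsum (k) :
      ContDiffOn ℝ ∞ (fun u => ∑ α, ∑ β, cmat α β * pd (wpot α i) k u * wpot β j u) U :=
    ContDiffOn.sum fun α _ => hrow k α
  refine exists_contDiffOn_forall_pd_eq hU hUc (fun k => (hΓs i j k).add (hsum k)) ?_
  intro k l u hu
  have hpd (k l) :
      pd (fun u => Γ i j k u + ∑ α, ∑ β, cmat α β * pd (wpot α i) k u * wpot β j u) l u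
        = pd (Γ i j k) l u + ∑ α, ∑ β, cmat α β *
            (pd (pd (wpot α i) k) l u * wpot β j u + pd (wpot α i) k u * pd (wpot β j) l u) := by
    rw [pd_add (hdiff (hΓs i j k) hu) (hdiff (hsum k) hu),
      pd_sum fun α _ => hdiff (hrow k α) hu]
    congr 1
    refine Finset.sum_congr rfl fun α _ => ?_
    rw [pd_sum fun β _ => hdiff (hterm k α β) hu]
    exact Finset.sum_congr rfl fun β _ =>
      pd_const_mul_mul _ (hdiff ((hw α i).pd hU k) hu) (hdiff (hw β j) hu) l
  have hswap : ∑ α, ∑ β, cmat α β * (pd (wpot α j) k u * pd (wpot β i) l u)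
      = ∑ α, ∑ β, cmat α β * (pd (wpot α i) l u * pd (wpot β j) k u) := by
    rw [Finset.sum_comm]
    refine Finset.sum_congr rfl fun α _ => Finset.sum_congr rfl fun β _ => ?_
    rw [hcmat β α]
    ring
  have hc := hcomp i j k l u hu
  have hsymm (α) : pd (pd (wpot α i) k) l u = pd (pd (wpot α i) l) k u :=
    pd_comm (hw α i) hU hu k l
  simp only [mul_sub, Finset.sum_sub_distrib] at hc
  refine (hpd k l).trans (Eq.trans ?_ (hpd l k).symm)
  simp only [mul_add, Finset.sum_add_distrib, hsymm]
  linarith
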